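/- arXiv:1808.02675 — 3 statements merged into one kernel-verified Lean document; each statement's English description precedes it below -/
import Mathlib

section
/- Let n ≥ 6 be an integer and let π be a packing 5-colouring of the circular ladder CL_n. For every integer i with 0 ≤ i ≤ n−1, if π(u_i) ≠ 1 and π(v_i) ≠ 1, then one of u_i, v_i has colour 2, and the three neighbours of that vertex have colours 3, 4 and 5 (in some order). -/
/-- A packing `k`-colouring of a simple graph `G`: every vertex gets a colour in
`{1, …, k}` and any two distinct vertices sharing a colour `i` are at distance
greater than `i` in `G` (i.e. every walk joining them has length greater than `i`). -/
def IsPackingColoring {V : Type*} (G : SimpleGraph V) (k : ℕ) (π : V → ℕ) : Prop :=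
  (∀ v, 1 ≤ π v ∧ π v ≤ k) ∧
    ∀ u v : V, u ≠ v → π u = π v → ∀ p : G.Walk u v, π u < p.length

/-- The packing chromatic number of `G`: the least `k` admitting a packing `k`-colouring. -/
noncomputable def packingChromaticNumber {V : Type*} (G : SimpleGraph V) : ℕ :=
  sInf {k | ∃ π : V → ℕ, IsPackingColoring G k π}

/-- The circular ladder `CLₙ = Cₙ □ K₂`: vertices `uᵢ = Sum.inl i` and `vᵢ = Sum.inr i`
(`i : ZMod n`), with edges `uᵢuᵢ₊₁`, `vᵢvᵢ₊₁` and `uᵢvᵢ`. -/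
def circularLadder (n : ℕ) : SimpleGraph (ZMod n ⊕ ZMod n) :=
  SimpleGraph.fromRel (fun x y =>
    (∃ i : ZMod n, x = Sum.inl i ∧ y = Sum.inl (i + 1)) ∨
    (∃ i : ZMod n, x = Sum.inr i ∧ y = Sum.inr (i + 1)) ∨
    (∃ i : ZMod n, x = Sum.inl i ∧ y = Sum.inr i))

/-- The colours `p = (π uⱼ, π vⱼ)` and `q` of two columns of a ladder that are `d` steps apart
respect the packing condition. -/
abbrev ColumnsCompatible (d : ℕ) (p q : ℕ × ℕ) : Prop :=
  (p.1 = q.1 → p.1 < d) ∧ (p.2 = q.2 → p.2 < d) ∧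
    (p.1 = q.2 → p.1 < d + 1) ∧ (p.2 = q.1 → p.2 < d + 1)

/-- The possible colour pairs of a column in a packing 5-colouring of a ladder. -/
abbrev columnColours : Finset (ℕ × ℕ) := (Finset.Icc 1 5 ×ˢ Finset.Icc 1 5).filter fun p ↦ p.1 ≠ p.2

/-- One of the vertices of the column `p`, between the columns `q` and `r`, has colour 2, and its
three neighbours have colours 3, 4, 5. -/
abbrev HasColourTwoCentre (q p r : ℕ × ℕ) : Prop :=
  p.1 = 2 ∧ ({r.1, q.1, p.2} : Finset ℕ) = {3, 4, 5} ∨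
    p.2 = 2 ∧ ({r.2, q.2, p.1} : Finset ℕ) = {3, 4, 5}

set_option synthInstance.maxSize 4000 in
/-- Seven consecutive columns `q₃ q₂ q₁ p r₁ r₂ r₃` suffice to force the colours around a column
without colour 1. The hypotheses are ordered so that the exhaustive search is pruned early. -/
lemma hasColourTwoCentre_of_compatible :
    ∀ p ∈ columnColours, p.1 ≠ 1 → p.2 ≠ 1 →
    ∀ r₁ ∈ columnColours, ColumnsCompatible 1 p r₁ →
    ∀ q₁ ∈ columnColours, ColumnsCompatible 1 q₁ p → ColumnsCompatible 2 q₁ r₁ →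
    ¬ HasColourTwoCentre q₁ p r₁ →
    ∀ r₂ ∈ columnColours, ColumnsCompatible 1 r₁ r₂ → ColumnsCompatible 2 p r₂ →
      ColumnsCompatible 3 q₁ r₂ →
    ∀ q₂ ∈ columnColours, ColumnsCompatible 1 q₂ q₁ → ColumnsCompatible 2 q₂ p →
      ColumnsCompatible 3 q₂ r₁ → ColumnsCompatible 4 q₂ r₂ →
    ∀ r₃ ∈ columnColours, ColumnsCompatible 1 r₂ r₃ → ColumnsCompatible 2 r₁ r₃ →
      ColumnsCompatible 3 p r₃ → ColumnsCompatible 4 q₁ r₃ → ColumnsCompatible 5 q₂ r₃ →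
    ∀ q₃ ∈ columnColours, ColumnsCompatible 1 q₃ q₂ → ColumnsCompatible 2 q₃ q₁ →
      ColumnsCompatible 3 q₃ p → ColumnsCompatible 4 q₃ r₁ → ColumnsCompatible 5 q₃ r₂ →
      False := by
  decide +kernel

section circularLadder

variable {n : ℕ}

lemma ZMod.add_natCast_ne_self {d : ℕ} (hd : 0 < d) (hdn : d < n) (j : ZMod n) : j ≠ j + d := by
  intro h
  have h0 : (d : ZMod n) = 0 := by simpa using h
  exact absurd (Nat.le_of_dvd hd ((ZMod.natCast_eq_zero_iff d n).1 h0)) (by omega)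

lemma circularLadder_adj_inl_inr (j : ZMod n) :
    (circularLadder n).Adj (Sum.inl j) (Sum.inr j) := by
  simp [circularLadder]

lemma circularLadder_adj_inl_succ (hn : 1 < n) (j : ZMod n) :
    (circularLadder n).Adj (Sum.inl j) (Sum.inl (j + 1)) := by
  have := ZMod.add_natCast_ne_self one_pos hn j
  simp_all [circularLadder]

lemma circularLadder_adj_inr_succ (hn : 1 < n) (j : ZMod n) :
    (circularLadder n).Adj (Sum.inr j) (Sum.inr (j + 1)) := by
  have := ZMod.add_natCast_ne_self one_pos hn j
  simp_all [circularLadder]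

lemma circularLadder_adj_inl_iff (hn : 1 < n) (j : ZMod n) (w : ZMod n ⊕ ZMod n) :
    (circularLadder n).Adj (Sum.inl j) w ↔
      w = Sum.inl (j + 1) ∨ w = Sum.inl (j - 1) ∨ w = Sum.inr j := by
  constructor
  · rcases w with w | w <;> simp only [circularLadder, SimpleGraph.fromRel_adj] <;> grind
  · rintro (rfl | rfl | rfl)
    · exact circularLadder_adj_inl_succ hn j
    · simpa using (circularLadder_adj_inl_succ hn (j - 1)).symm
    · exact circularLadder_adj_inl_inr j

lemma circularLadder_adj_inr_iff (hn : 1 < n) (j : ZMod n) (w : ZMod n ⊕ ZMod n) :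
    (circularLadder n).Adj (Sum.inr j) w ↔
      w = Sum.inr (j + 1) ∨ w = Sum.inr (j - 1) ∨ w = Sum.inl j := by
  constructor
  · rcases w with w | w <;> simp only [circularLadder, SimpleGraph.fromRel_adj] <;> grind
  · rintro (rfl | rfl | rfl)
    · exact circularLadder_adj_inr_succ hn j
    · simpa using (circularLadder_adj_inr_succ hn (j - 1)).symm
    · exact (circularLadder_adj_inl_inr j).symm

lemma circularLadder_exists_walk_inl (hn : 1 < n) (j : ZMod n) (d : ℕ) :
    ∃ w : (circularLadder n).Walk (Sum.inl j) (Sum.inl (j + d)), w.length = d := by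
  induction d with
  | zero => exact ⟨SimpleGraph.Walk.nil.copy rfl (by simp), by simp⟩
  | succ d ih =>
    obtain ⟨w, hw⟩ := ih
    exact ⟨(w.concat (circularLadder_adj_inl_succ hn _)).copy rfl (by push_cast; ring_nf),
      by simp [hw]⟩

lemma circularLadder_exists_walk_inr (hn : 1 < n) (j : ZMod n) (d : ℕ) :
    ∃ w : (circularLadder n).Walk (Sum.inr j) (Sum.inr (j + d)), w.length = d := by
  induction d with
  | zero => exact ⟨SimpleGraph.Walk.nil.copy rfl (by simp), by simp⟩
  | succ d ih =>
    obtain ⟨w, hw⟩ := ih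
    exact ⟨(w.concat (circularLadder_adj_inr_succ hn _)).copy rfl (by push_cast; ring_nf),
      by simp [hw]⟩

lemma IsPackingColoring.columnsCompatible {k : ℕ} {π : ZMod n ⊕ ZMod n → ℕ}
    (hπ : IsPackingColoring (circularLadder n) k π) {d : ℕ} (hd : 0 < d) (hdn : d < n)
    {j l : ZMod n} (hl : l = j + d) :
    ColumnsCompatible d (π (Sum.inl j), π (Sum.inr j)) (π (Sum.inl l), π (Sum.inr l)) := by
  subst hl
  have hne := ZMod.add_natCast_ne_self hd hdn j
  obtain ⟨w, hw⟩ := circularLadder_exists_walk_inl (by omega) j d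
  obtain ⟨w', hw'⟩ := circularLadder_exists_walk_inr (by omega) j d
  refine ⟨fun h ↦ ?_, fun h ↦ ?_, fun h ↦ ?_, fun h ↦ ?_⟩
  · simpa [hw] using hπ.2 _ _ (by simpa using hne) h w
  · simpa [hw'] using hπ.2 _ _ (by simpa using hne) h w'
  · simpa [hw] using hπ.2 _ _ (by simp) h (w.concat (circularLadder_adj_inl_inr _))
  · simpa [hw'] using hπ.2 _ _ (by simp) h (w'.concat (circularLadder_adj_inl_inr _).symm)

lemma IsPackingColoring.mem_columnColours {π : ZMod n ⊕ ZMod n → ℕ}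
    (hπ : IsPackingColoring (circularLadder n) 5 π) (j : ZMod n) :
    (π (Sum.inl j), π (Sum.inr j)) ∈ columnColours := by
  have hu := hπ.1 (Sum.inl j)
  have hv := hπ.1 (Sum.inr j)
  have hne : π (Sum.inl j) ≠ π (Sum.inr j) := fun h ↦ by
    have := hπ.2 _ _ (by simp) h (circularLadder_adj_inl_inr j).toWalk
    simp at this
    omega
  simp [hu, hv, hne]

lemma IsPackingColoring.hasColourTwoCentre (hn : 6 ≤ n) {π : ZMod n ⊕ ZMod n → ℕ}
    (hπ : IsPackingColoring (circularLadder n) 5 π) {i : ZMod n}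
    (hu : π (Sum.inl i) ≠ 1) (hv : π (Sum.inr i) ≠ 1) :
    HasColourTwoCentre (π (Sum.inl (i - 1)), π (Sum.inr (i - 1)))
      (π (Sum.inl i), π (Sum.inr i)) (π (Sum.inl (i + 1)), π (Sum.inr (i + 1))) := by
  by_contra h
  have compat {d : ℕ} (hd : 0 < d) (hd' : d < 6) {j l : ZMod n} (hl : l = j + d) :=
    hπ.columnsCompatible hd (hd'.trans_le hn) hl
  refine hasColourTwoCentre_of_compatible _ (hπ.mem_columnColours i) hu hv
    _ (hπ.mem_columnColours (i + 1)) ?_ _ (hπ.mem_columnColours (i - 1)) ?_ ?_ h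
    _ (hπ.mem_columnColours (i + 2)) ?_ ?_ ?_ _ (hπ.mem_columnColours (i - 2)) ?_ ?_ ?_ ?_
    _ (hπ.mem_columnColours (i + 3)) ?_ ?_ ?_ ?_ ?_
    _ (hπ.mem_columnColours (i - 3)) ?_ ?_ ?_ ?_ ?_ <;>
  exact compat (by norm_num) (by norm_num) (by push_cast; ring)

end circularLadder

theorem circularLadder_colour_two (n : ℕ) (hn : 6 ≤ n) (π : ZMod n ⊕ ZMod n → ℕ)
    (hπ : IsPackingColoring (circularLadder n) 5 π) (i : ZMod n)
    (hu : π (Sum.inl i) ≠ 1) (hv : π (Sum.inr i) ≠ 1) :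
    ∃ c ∈ ({Sum.inl i, Sum.inr i} : Set (ZMod n ⊕ ZMod n)),
      π c = 2 ∧ π '' {w | (circularLadder n).Adj c w} = {3, 4, 5} := by
  have hn' : 1 < n := by omega
  rcases hπ.hasColourTwoCentre hn hu hv with ⟨h2, h⟩ | ⟨h2, h⟩
  · refine ⟨Sum.inl i, by simp, h2, ?_⟩
    have hN : {w | (circularLadder n).Adj (Sum.inl i) w} =
        {Sum.inl (i + 1), Sum.inl (i - 1), Sum.inr i} :=
      Set.ext (circularLadder_adj_inl_iff hn' i)
    rw [hN, Set.image_insert_eq, Set.image_pair]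
    simpa using congrArg (fun s : Finset ℕ ↦ (s : Set ℕ)) h
  · refine ⟨Sum.inr i, by simp, h2, ?_⟩
    have hN : {w | (circularLadder n).Adj (Sum.inr i) w} =
        {Sum.inr (i + 1), Sum.inr (i - 1), Sum.inl i} :=
      Set.ext (circularLadder_adj_inr_iff hn' i)
    rw [hN, Set.image_insert_eq, Set.image_pair]
    simpa using congrArg (fun s : Finset ℕ ↦ (s : Set ℕ)) h
end

section
/- For every integer n ≥ 3, the packing chromatic number of the circular ladder CL_n equals 5 if n = 3 or if n is even and n ∉ {8,14}; it equals 7 if n ∈ {7,8,9}; and it equals 6 in all remaining cases (namely n = 5, n = 14, and odd n ≥ 11). -/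
/-- The distance contribution of the rows: `0` within a row, `1` across the two rows. -/
def rowDist (r s : Bool) : ℕ := if r = s then 0 else 1

/-- The vertex of the circular ladder in column `i` and row `r`. -/
def ladderVertex {n : ℕ} (i : ZMod n) (r : Bool) : ZMod n ⊕ ZMod n :=
  bif r then Sum.inr i else Sum.inl i

/-- A packing `k`-colouring of `CLₙ`, unrolled to an `n`-periodic colouring of the two-way
infinite ladder. -/
structure IsLadderColoring (n k : ℕ) (F : ℤ → Bool → ℕ) : Prop where
  pos : ∀ i r, 1 ≤ F i r
  le : ∀ i r, F i r ≤ k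
  periodic : ∀ i r, F (i + n) r = F i r
  lt : ∀ (i : ℤ) (d : ℕ) (r s : Bool), (r ≠ s ∨ ¬ n ∣ d) → F i r = F (i + d) s →
    F i r < d + rowDist r s

/-! ### Walks in the circular ladder -/

theorem exists_eq_ladderVertex {n : ℕ} (v : ZMod n ⊕ ZMod n) :
    ∃ i r, v = ladderVertex i r := by
  rcases v with i | i
  · exact ⟨i, false, rfl⟩
  · exact ⟨i, true, rfl⟩

theorem ladderVertex_inj {n : ℕ} {i j : ZMod n} {r s : Bool} :
    ladderVertex i r = ladderVertex j s ↔ i = j ∧ r = s := by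
  cases r <;> cases s <;> simp [ladderVertex]

theorem circularLadder_adj_horizontal {n : ℕ} (hn : 2 ≤ n) (i : ZMod n) (r : Bool) :
    (circularLadder n).Adj (ladderVertex i r) (ladderVertex (i + 1) r) := by
  have : Fact (1 < n) := ⟨hn⟩
  cases r <;> simp [circularLadder, ladderVertex]

theorem circularLadder_adj_rung {n : ℕ} (i : ZMod n) {r s : Bool} (h : r ≠ s) :
    (circularLadder n).Adj (ladderVertex i r) (ladderVertex i s) := by
  cases r <;> cases s <;> simp_all [circularLadder, ladderVertex]

theorem exists_walk_ladderVertex {n : ℕ} (hn : 2 ≤ n) (i : ZMod n) (d : ℕ) (r s : Bool) :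
    ∃ p : (circularLadder n).Walk (ladderVertex i r) (ladderVertex (i + d) s),
      p.length = d + rowDist r s := by
  induction d generalizing i with
  | zero =>
    rw [Nat.cast_zero, add_zero]
    by_cases h : r = s
    · subst h
      exact ⟨.nil, by simp [rowDist]⟩
    · exact ⟨.cons (circularLadder_adj_rung i h) .nil, by simp [rowDist, h]⟩
  | succ d ih =>
    obtain ⟨p, hp⟩ := ih (i + 1)
    have e : i + ((d + 1 : ℕ) : ZMod n) = i + 1 + d := by push_cast; ring
    rw [e]
    exact ⟨.cons (circularLadder_adj_horizontal hn i r) p, by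
      rw [SimpleGraph.Walk.length_cons, hp]; omega⟩

theorem exists_displacement_of_adj {n : ℕ} {i j : ZMod n} {r s : Bool}
    (h : (circularLadder n).Adj (ladderVertex i r) (ladderVertex j s)) :
    ∃ z : ℤ, j = i + z ∧ z.natAbs + rowDist r s ≤ 1 := by
  cases r <;> cases s <;> simp [circularLadder, ladderVertex] at h
  · rcases h.2 with h | h
    · exact ⟨1, by simp [h], by decide⟩
    · exact ⟨-1, by simp [h], by decide⟩
  · exact ⟨0, by simp [h], by decide⟩
  · exact ⟨0, by simp [h], by decide⟩
  · rcases h.2 with h | h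
    · exact ⟨1, by simp [h], by decide⟩
    · exact ⟨-1, by simp [h], by decide⟩

theorem rowDist_triangle (r s t : Bool) : rowDist r t ≤ rowDist r s + rowDist s t := by
  revert r s t; decide

theorem rowDist_comm (r s : Bool) : rowDist r s = rowDist s r := by
  revert r s; decide

theorem exists_displacement_of_walk {n : ℕ} {u v : ZMod n ⊕ ZMod n}
    (p : (circularLadder n).Walk u v) :
    ∀ {i j : ZMod n} {r s : Bool}, u = ladderVertex i r → v = ladderVertex j s →
      ∃ z : ℤ, j = i + z ∧ z.natAbs + rowDist r s ≤ p.length := by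
  induction p with
  | nil =>
    intro i j r s hu hv
    obtain ⟨rfl, rfl⟩ := ladderVertex_inj.1 (hu.symm.trans hv)
    exact ⟨0, by simp, by simp [rowDist]⟩
  | @cons u w v h p ih =>
    intro i j r s hu hv
    obtain ⟨l, t, rfl⟩ := exists_eq_ladderVertex w
    subst hu
    obtain ⟨y, rfl, hy⟩ := exists_displacement_of_adj h
    obtain ⟨z, rfl, hz⟩ := ih rfl hv
    refine ⟨y + z, by push_cast; ring, ?_⟩
    have := rowDist_triangle r t s
    rw [SimpleGraph.Walk.length_cons]
    omega

/-! ### Packing colourings as periodic colourings -/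

theorem exists_isLadderColoring {n k : ℕ} (hn : 2 ≤ n) {π : ZMod n ⊕ ZMod n → ℕ}
    (h : IsPackingColoring (circularLadder n) k π) : ∃ F, IsLadderColoring n k F := by
  refine ⟨fun i r => π (ladderVertex (i : ZMod n) r), fun i r => (h.1 _).1, fun i r => (h.1 _).2,
    fun i r => by simp, fun i d r s hne heq => ?_⟩
  obtain ⟨p, hp⟩ := exists_walk_ladderVertex hn (i : ZMod n) d r s
  rw [← hp]
  push_cast at heq
  refine h.2 _ _ (fun e => ?_) heq p
  obtain ⟨h₁, h₂⟩ := ladderVertex_inj.1 e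
  rcases hne with hne | hne
  · exact hne h₂
  · exact hne ((ZMod.natCast_eq_zero_iff _ _).1 (by simpa using h₁.symm))

/-- A colouring of the columns `0, …, n - 1` all of whose cyclic windows of width `k + 1` are
legal. -/
def IsCyclicColoring (n k : ℕ) (g : ℕ → Bool → ℕ) : Prop :=
  (∀ i < n, ∀ r, 1 ≤ g i r ∧ g i r ≤ k) ∧
    ∀ i < n, ∀ d < min n (k + 1), ∀ r s, (r ≠ s ∨ d ≠ 0) → g i r = g ((i + d) % n) s →
      g i r < d + rowDist r s

instance (n k : ℕ) (g : ℕ → Bool → ℕ) : Decidable (IsCyclicColoring n k g) := by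
  unfold IsCyclicColoring
  refine @instDecidableAnd _ _ ?_ ?_ <;> infer_instance

theorem IsCyclicColoring.lt_of_eq_add {n k : ℕ} [NeZero n] {g : ℕ → Bool → ℕ}
    (h : IsCyclicColoring n k g) {i j : ZMod n} {r s : Bool} (d : ℕ) (hj : j = i + d)
    (hne : i ≠ j ∨ r ≠ s) (heq : g i.val r = g j.val s) : g i.val r < d + rowDist r s := by
  have hi := ZMod.val_lt i
  have hd : d % n < n := Nat.mod_lt _ (NeZero.pos n)
  have hdd := Nat.mod_le d n
  by_cases hk : d % n < k + 1
  · have hval : j.val = (i.val + d % n) % n := by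
      rw [hj, ZMod.val_add, ZMod.val_natCast]
    have := h.2 i.val hi (d % n) (lt_min hd hk) r s ?_ (hval ▸ heq)
    · omega
    · rcases hne with hne | hne
      · refine Or.inr fun h0 => hne ?_
        rw [hj, (ZMod.natCast_eq_zero_iff _ _).2 (Nat.dvd_of_mod_eq_zero h0), add_zero]
      · exact Or.inl hne
  · have := (h.1 i.val hi r).2
    omega

theorem IsCyclicColoring.exists_isPackingColoring {n k : ℕ} [NeZero n] {g : ℕ → Bool → ℕ}
    (h : IsCyclicColoring n k g) :
    ∃ π : ZMod n ⊕ ZMod n → ℕ, IsPackingColoring (circularLadder n) k π := by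
  let π : ZMod n ⊕ ZMod n → ℕ := Sum.elim (fun i => g i.val false) (fun i => g i.val true)
  have hπ : ∀ i r, π (ladderVertex i r) = g i.val r := by
    intro i r; cases r <;> rfl
  refine ⟨π, fun v => ?_, fun u v huv heq p => ?_⟩
  · obtain ⟨i, r, rfl⟩ := exists_eq_ladderVertex v
    rw [hπ]
    exact h.1 _ (ZMod.val_lt i) r
  · obtain ⟨i, r, rfl⟩ := exists_eq_ladderVertex u
    obtain ⟨j, s, rfl⟩ := exists_eq_ladderVertex v
    obtain ⟨z, hz, hlen⟩ := exists_displacement_of_walk p rfl rfl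
    have hne : i ≠ j ∨ r ≠ s := by
      by_contra! hc
      exact huv (by rw [hc.1, hc.2])
    rw [hπ, hπ] at heq
    rw [hπ]
    refine lt_of_lt_of_le ?_ hlen
    rcases Int.natAbs_eq z with hz' | hz'
    · exact h.lt_of_eq_add _ (by rw [hz, hz']; simp) hne heq
    · rw [heq, rowDist_comm]
      refine h.lt_of_eq_add _ ?_ (hne.imp Ne.symm Ne.symm) heq.symm
      rw [hz, hz']; simp

/-! ### Exhaustive search -/

/-- Backtracking search for a colouring of the vertices `vs` extending the partial colouring
`acc`, where `v` takes its colour from `palette v` and `close u v c` forbids giving `c` to both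
`u` and `v`. -/
def searchColoring {V : Type*} (close : V → V → ℕ → Bool) (palette : V → List ℕ) :
    List V → List (V × ℕ) → Bool
  | [], _ => true
  | v :: vs, acc => (palette v).any fun c =>
      (acc.all fun p => !(Nat.beq p.2 c && close p.1 v c)) &&
        searchColoring close palette vs ((v, c) :: acc)

theorem searchColoring_map {V : Type*} {close : V → V → ℕ → Bool} {palette : V → List ℕ}
    {f : V → ℕ} (vs us : List V) (hp : ∀ v ∈ vs, f v ∈ palette v)
    (hu : ∀ u ∈ us, ∀ v ∈ vs, f u = f v → close u v (f v) = false)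
    (hv : vs.Pairwise fun u v => f u = f v → close u v (f v) = false) :
    searchColoring close palette vs (us.map fun u => (u, f u)) = true := by
  induction vs generalizing us with
  | nil => rfl
  | cons v vs ih =>
    rw [List.pairwise_cons] at hv
    rw [searchColoring, List.any_eq_true]
    refine ⟨f v, hp v List.mem_cons_self, ?_⟩
    rw [Bool.and_eq_true]
    constructor
    · rw [List.all_eq_true]
      intro p hp
      obtain ⟨u, hmem, rfl⟩ := List.mem_map.1 hp
      by_cases huv : f u = f v
      · simp [hu u hmem v List.mem_cons_self huv]
      · have : Nat.beq (f u) (f v) = false := 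
          Bool.eq_false_iff.2 fun h => huv (Nat.eq_of_beq_eq_true h)
        simp [this]
    · refine ih (v :: us) (fun w hw => hp w (List.mem_cons_of_mem _ hw)) ?_ hv.2
      intro u hmem w hw
      rcases List.mem_cons.1 hmem with rfl | hmem
      · exact hv.1 w hw
      · exact hu u hmem w (List.mem_cons_of_mem _ hw)

/-- Columns `0, …, m - 1` of the ladder, column by column. -/
def ladderCells (m : ℕ) : List (ℕ × Bool) :=
  (List.range m).flatMap fun i => [(i, false), (i, true)]

theorem mem_ladderCells {m : ℕ} {v : ℕ × Bool} : v ∈ ladderCells m ↔ v.1 < m := by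
  obtain ⟨i, r⟩ := v
  cases r <;> simp [ladderCells]

theorem nodup_ladderCells (m : ℕ) : (ladderCells m).Nodup := by
  rw [ladderCells, List.nodup_flatMap]
  refine ⟨fun i _ => by simp, List.nodup_range.imp fun {i j} hij => ?_⟩
  simp [hij, Function.onFun, List.disjoint_left]

/-- Two cells of the infinite ladder are at distance at most `c`. -/
def stripClose (u v : ℕ × Bool) (c : ℕ) : Bool :=
  Nat.ble (u.1 - v.1 + (v.1 - u.1) + rowDist u.2 v.2) c

/-- Two cells of the circular ladder of length `n` are at distance at most `c`. -/
def cyclicClose (n : ℕ) (u v : ℕ × Bool) (c : ℕ) : Bool :=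
  stripClose u v c || Nat.ble (n - (u.1 - v.1 + (v.1 - u.1)) + rowDist u.2 v.2) c

theorem searchColoring_ladderCells {m : ℕ} {close : ℕ × Bool → ℕ × Bool → ℕ → Bool}
    {palette : ℕ × Bool → List ℕ} {f : ℕ × Bool → ℕ}
    (hp : ∀ v, v.1 < m → f v ∈ palette v)
    (hf : ∀ u v, u.1 < m → v.1 < m → u ≠ v → f u = f v → close u v (f v) = false) :
    searchColoring close palette (ladderCells m) [] = true := by
  refine searchColoring_map (f := f) _ [] (fun v hv => hp v (mem_ladderCells.1 hv)) (by simp) ?_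
  exact (nodup_ladderCells m).imp_of_mem fun {u v} hu hv huv =>
    hf u v (mem_ladderCells.1 hu) (mem_ladderCells.1 hv) huv

namespace IsLadderColoring

variable {n k : ℕ} {F : ℤ → Bool → ℕ}

theorem translate (h : IsLadderColoring n k F) (a : ℤ) (b : Bool) :
    IsLadderColoring n k fun i r => F (a + i) (xor b r) := by
  refine ⟨fun i r => h.pos _ _, fun i r => h.le _ _, fun i r => ?_, fun i d r s hne heq => ?_⟩
  · rw [← add_assoc, h.periodic]
  · have := h.lt (a + i) d (xor b r) (xor b s) (hne.imp_left (by simp)) (by rw [heq, add_assoc])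
    simpa [rowDist] using this

theorem lt_of_eq (h : IsLadderColoring n k F) (hk : k < n) {i j : ℤ} {r s : Bool}
    (hne : i ≠ j ∨ r ≠ s) (heq : F i r = F j s) :
    F i r < (j - i).natAbs + rowDist r s := by
  wlog hij : i ≤ j generalizing i j r s
  · have := this (hne.imp Ne.symm Ne.symm) heq.symm (by omega)
    rw [heq, rowDist_comm]
    omega
  obtain ⟨d, rfl⟩ := Int.le.dest hij
  have := h.le i r
  by_cases hd : d < n
  · have := h.lt i d r s ?_ heq
    · simpa using this
    · rcases hne with hne | hne
      · exact Or.inr fun hdvd => hne (by simp [Nat.eq_zero_of_dvd_of_lt hdvd hd])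
      · exact Or.inl hne
  · omega

theorem searchColoring_stripClose (h : IsLadderColoring n k F) (hk : k < n) (a : ℤ) (m : ℕ)
    {palette : ℕ × Bool → List ℕ} (hp : ∀ v, v.1 < m → F (a + v.1) v.2 ∈ palette v) :
    searchColoring stripClose palette (ladderCells m) [] = true := by
  refine searchColoring_ladderCells (f := fun v => F (a + v.1) v.2) hp ?_
  intro u v _ _ huv heq
  have := h.lt_of_eq hk (i := a + u.1) (j := a + v.1) ?_ heq
  · rw [stripClose, Bool.eq_false_iff, Ne, Nat.ble_eq]
    omega
  · by_contra! hc
    exact huv (Prod.ext (by omega) hc.2)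

theorem searchColoring_cyclicClose (h : IsLadderColoring n k F)
    {palette : ℕ × Bool → List ℕ} (hp : ∀ v, v.1 < n → F v.1 v.2 ∈ palette v) :
    searchColoring (cyclicClose n) palette (ladderCells n) [] = true := by
  have key : ∀ i j : ℕ, ∀ r s, i ≤ j → j < n → (i, r) ≠ (j, s) → F i r = F j s →
      F i r < j - i + rowDist r s ∧ F i r < n - (j - i) + rowDist r s := by
    intro i j r s hij hj hne heq
    have hne' : r ≠ s ∨ i ≠ j := by
      by_contra! hc
      exact hne (by rw [hc.1, hc.2])
    constructor
    · refine h.lt i (j - i) r s (hne'.imp_right fun h' hdvd => ?_) ?_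
      · have := Nat.eq_zero_of_dvd_of_lt hdvd (by omega)
        omega
      · rw [heq]; congr 1; omega
    · rw [heq, rowDist_comm]
      refine h.lt j (n - (j - i)) s r (hne'.imp Ne.symm fun h' hdvd => ?_) ?_
      · have := Nat.eq_zero_of_dvd_of_lt hdvd (by omega)
        omega
      · rw [← heq, ← h.periodic i]; congr 1; omega
  refine searchColoring_ladderCells (f := fun v => F v.1 v.2) hp ?_
  intro u v hu hv huv heq
  rw [cyclicClose, stripClose, Bool.or_eq_false_iff, Bool.eq_false_iff, Ne, Nat.ble_eq,
    Bool.eq_false_iff, Ne, Nat.ble_eq]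
  rcases le_total u.1 v.1 with hle | hle
  · have := key u.1 v.1 u.2 v.2 hle hv huv heq
    omega
  · have := key v.1 u.1 v.2 u.2 hle hu huv.symm heq.symm
    rw [rowDist_comm] at this
    omega

theorem mem_range' (h : IsLadderColoring n k F) (i : ℤ) (r : Bool) :
    F i r ∈ List.range' 1 k := by
  have := h.pos i r
  have := h.le i r
  rw [List.mem_range'_1]
  omega

end IsLadderColoring

/-- The palette in which the colour `k` is prescribed at the origin. -/
def rootedPalette (k : ℕ) : ℕ × Bool → List ℕ
  | (0, false) => [k]
  | _ => List.range' 1 k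

theorem not_isLadderColoring_of_search {n k : ℕ}
    (hs : ∀ l < k, searchColoring (cyclicClose n) (rootedPalette (l + 1)) (ladderCells n) []
      = false) (F : ℤ → Bool → ℕ) : ¬ IsLadderColoring n k F := by
  induction k generalizing F with
  | zero =>
    intro h
    have := h.pos 0 false
    have := h.le 0 false
    omega
  | succ k ih =>
    intro h
    by_cases hmax : ∃ a b, F a b = k + 1
    · obtain ⟨a, b, hab⟩ := hmax
      have h' := h.translate a b
      refine Bool.false_ne_true ((hs k (by omega)).symm.trans (h'.searchColoring_cyclicClose ?_))
      rintro ⟨i, r⟩ -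
      unfold rootedPalette
      split
      · simp_all
      · exact h'.mem_range' _ _
    · push Not at hmax
      refine ih (fun l hl => hs l (by omega)) F ⟨h.pos, fun i r => ?_, h.periodic, h.lt⟩
      have := h.le i r
      have := hmax i r
      omega

/-! ### Lower bounds -/

theorem not_isLadderColoring_four {n : ℕ} (hn : 3 ≤ n) (F : ℤ → Bool → ℕ) :
    ¬ IsLadderColoring n 4 F := by
  obtain rfl | rfl | hn : n = 3 ∨ n = 4 ∨ 5 ≤ n := by omega
  · exact not_isLadderColoring_of_search (by decide +kernel) F
  · exact not_isLadderColoring_of_search (by decide +kernel) F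
  · intro h
    refine absurd (h.searchColoring_stripClose (palette := fun _ => List.range' 1 4) hn 0 6
      fun v _ => h.mem_range' _ _) (by decide +kernel)

namespace IsLadderColoring

variable {n : ℕ} {F : ℤ → Bool → ℕ}

theorem mem_range'_two {k : ℕ} (h : IsLadderColoring n (k + 1) F) {i : ℤ} {r : Bool}
    (hne : F i r ≠ 1) : F i r ∈ List.range' 2 k := by
  have := h.pos i r
  have := h.le i r
  rw [List.mem_range'_1]
  omega

theorem exists_eq_one_of_consecutive (h : IsLadderColoring n 5 F) (hn : 6 ≤ n) (i : ℤ) :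
    ∃ r, F i r = 1 ∨ F (i + 1) r = 1 := by
  by_contra! hc
  refine absurd (h.searchColoring_stripClose (n := n) (by omega) (i - 1) 4
    (palette := fun v => if v.1 = 1 ∨ v.1 = 2 then List.range' 2 4 else List.range' 1 5) ?_)
    (by decide +kernel)
  rintro ⟨j, r⟩ -
  dsimp only
  split_ifs with hj
  · refine h.mem_range'_two ?_
    rcases hj with rfl | rfl
    · simpa using (hc r).1
    · rw [show i - 1 + ((2 : ℕ) : ℤ) = i + 1 by push_cast; ring]
      exact (hc r).2
  · exact h.mem_range' _ _

theorem ne_one_of_gap (h : IsLadderColoring n 5 F) (hn : 6 ≤ n) {i : ℤ} {b : Bool}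
    (hb : F i b = 1) (hgap : ∀ r, F (i + 1) r ≠ 1) : F (i + 2) (!b) ≠ 1 := by
  intro hc
  have h' := h.translate (i - 2) b
  refine absurd (h'.searchColoring_stripClose (n := n) (by omega) 0 7
    (palette := fun v => if v = (2, false) ∨ v = (4, true) then [1] else
      if v.1 = 3 then List.range' 2 4 else List.range' 1 5) ?_)
    (by decide +kernel)
  rintro ⟨j, r⟩ -
  dsimp only
  split_ifs with h₁ h₂
  · rcases h₁ with h₁ | h₁ <;> obtain ⟨rfl, rfl⟩ := Prod.mk.inj h₁
    · simpa using hb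
    · rw [show i - 2 + (0 + ((4 : ℕ) : ℤ)) = i + 2 by push_cast; ring]
      simpa using hc
  · subst h₂
    refine h'.mem_range'_two ?_
    rw [show i - 2 + (0 + ((3 : ℕ) : ℤ)) = i + 1 by push_cast; ring]
    exact hgap _
  · exact h'.mem_range' _ _

/-- The colour `1` occupies the top row in column `i`, where a column without colour `1` counts
as continuing the alternation of its neighbours. -/
def TopPhase (F : ℤ → Bool → ℕ) (i : ℤ) : Prop :=
  F i false = 1 ∨ (F i true ≠ 1 ∧ F (i + 1) true = 1)

theorem topPhase_add_one (h : IsLadderColoring n 5 F) (hn : 6 ≤ n) (i : ℤ) :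
    TopPhase F (i + 1) ↔ ¬ TopPhase F i := by
  have e : i + 1 + 1 = i + 2 := by ring
  have hrow : ∀ j r, F j r = 1 → F (j + 1) r ≠ 1 := by
    intro j r h₁ h₂
    have := h.lt_of_eq (by omega) (i := j) (j := j + 1) (by simp) (h₁.trans h₂.symm)
    simp [rowDist, h₁] at this
  have hcol : ∀ j, F j false = 1 → F j true ≠ 1 := by
    intro j h₁ h₂
    have := h.lt_of_eq (by omega) (i := j) (j := j) (r := false) (s := true) (by simp)
      (h₁.trans h₂.symm)
    simp [rowDist, h₁] at this
  have h₀ := h.exists_eq_one_of_consecutive hn i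
  have h₁ := h.exists_eq_one_of_consecutive hn (i + 1)
  have h₂ := h.ne_one_of_gap hn (i := i) (b := false)
  have h₃ := h.ne_one_of_gap hn (i := i) (b := true)
  have h₄ := hrow i false
  have h₅ := hrow i true
  have h₆ := hcol i
  have h₇ := hcol (i + 1)
  simp only [Bool.exists_bool, Bool.forall_bool, Bool.not_false, Bool.not_true, e] at h₀ h₁ h₂ h₃
  simp only [TopPhase, e]
  grind

theorem even_of_six_le (h : IsLadderColoring n 5 F) (hn : 6 ≤ n) : Even n := by
  have hphase : ∀ m : ℕ, TopPhase F m ↔ (Even m ↔ TopPhase F 0) := by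
    intro m
    induction m with
    | zero => simp
    | succ m ih =>
      push_cast
      rw [h.topPhase_add_one hn, ih, Nat.even_add_one]
      by_cases hm : Even m <;> simp [hm]
  have hper : TopPhase F n ↔ TopPhase F 0 := by
    have h₁ := h.periodic 0
    have h₂ := h.periodic (0 + 1)
    simp only [TopPhase]
    rw [zero_add] at h₁
    rw [show (n : ℤ) + 1 = 0 + 1 + n by ring, h₂, h₁, h₁]
  have := hphase n
  tauto

end IsLadderColoring

theorem not_isLadderColoring_five {n : ℕ} (hn : Odd n ∧ 5 ≤ n ∨ n = 8 ∨ n = 14)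
    (F : ℤ → Bool → ℕ) : ¬ IsLadderColoring n 5 F := by
  obtain ⟨hodd, hn⟩ | rfl | rfl := hn
  · obtain rfl | hn : n = 5 ∨ 6 ≤ n := by omega
    · exact not_isLadderColoring_of_search (by decide +kernel) F
    · exact fun h => Nat.not_even_iff_odd.2 hodd (h.even_of_six_le hn)
  · exact not_isLadderColoring_of_search (by decide +kernel) F
  · exact not_isLadderColoring_of_search (by decide +kernel) F

theorem not_isLadderColoring_six {n : ℕ} (hn : n = 7 ∨ n = 8 ∨ n = 9)
    (F : ℤ → Bool → ℕ) : ¬ IsLadderColoring n 6 F := by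
  obtain rfl | rfl | rfl := hn <;>
    exact not_isLadderColoring_of_search (by decide +kernel) F

/-! ### Upper bounds -/

/-- The colouring whose columns, read from column `0`, are the pairs in `L`. -/
def columnColoring (L : List (ℕ × ℕ)) (i : ℕ) (r : Bool) : ℕ :=
  bif r then (L.getD i (0, 0)).2 else (L.getD i (0, 0)).1

/-- The columns of the colouring of period `6` with five colours. -/
def hexBlock : List (ℕ × ℕ) := [(1, 2), (3, 1), (1, 4), (2, 1), (1, 3), (5, 1)]

/-- The colouring that starts with the columns `L` and continues with copies of `hexBlock`. -/
def prefixedColoring (L : List (ℕ × ℕ)) (i : ℕ) (r : Bool) : ℕ :=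
  if i < L.length then columnColoring L i r else columnColoring hexBlock ((i - L.length) % 6) r

theorem prefixedColoring_congr {L : List (ℕ × ℕ)} {i j : ℕ} (hi : L.length ≤ i)
    (hj : L.length ≤ j) (h : (i - L.length) % 6 = (j - L.length) % 6) :
    prefixedColoring L i = prefixedColoring L j := by
  funext r
  rw [prefixedColoring, prefixedColoring, if_neg (by omega), if_neg (by omega), h]

theorem isCyclicColoring_prefixedColoring {L : List (ℕ × ℕ)} {k : ℕ} (hk : k ≤ 6)
    (h : IsCyclicColoring (L.length + 12) k (prefixedColoring L)) {a : ℕ} (ha : 2 ≤ a) :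
    IsCyclicColoring (L.length + 6 * a) k (prefixedColoring L) := by
  have key : ∀ i < L.length + 6 * a, ∃ j < L.length + 12,
      prefixedColoring L i = prefixedColoring L j ∧
      ∀ d ≤ 6, prefixedColoring L ((i + d) % (L.length + 6 * a)) =
        prefixedColoring L ((j + d) % (L.length + 12)) := by
    intro i hi
    by_cases h₁ : i < L.length + 6
    · refine ⟨i, by omega, rfl, fun d hd => ?_⟩
      rw [Nat.mod_eq_of_lt (by omega), Nat.mod_eq_of_lt (by omega)]
    by_cases h₂ : i < L.length + 6 * (a - 1)
    · refine ⟨L.length + (i - L.length) % 6, by omega,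
        prefixedColoring_congr (by omega) (by omega) (by omega), fun d hd => ?_⟩
      rw [Nat.mod_eq_of_lt (by omega), Nat.mod_eq_of_lt (by omega)]
      exact prefixedColoring_congr (by omega) (by omega) (by omega)
    · refine ⟨i - 6 * (a - 2), by omega,
        prefixedColoring_congr (by omega) (by omega) (by omega), fun d hd => ?_⟩
      by_cases h₃ : i + d < L.length + 6 * a
      · rw [Nat.mod_eq_of_lt h₃, Nat.mod_eq_of_lt (by omega)]
        exact prefixedColoring_congr (by omega) (by omega) (by omega)
      · rw [Nat.mod_eq_sub_mod (by omega), Nat.mod_eq_sub_mod (a := i - 6 * (a - 2) + d) (by omega),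
          Nat.mod_eq_of_lt (by omega), Nat.mod_eq_of_lt (by omega)]
        congr 1
        omega
  refine ⟨fun i hi r => ?_, fun i hi d hd r s hne heq => ?_⟩
  · obtain ⟨j, hj, hij, -⟩ := key i hi
    rw [hij]
    exact h.1 j hj r
  · obtain ⟨j, hj, hij, hd'⟩ := key i hi
    rw [hij, hd' d (by omega)] at heq
    rw [hij]
    exact h.2 j hj d (by omega) r s hne heq

theorem exists_isCyclicColoring_five {n : ℕ} (hn : 3 ≤ n)
    (h : n = 3 ∨ (Even n ∧ n ≠ 8 ∧ n ≠ 14)) : ∃ g, IsCyclicColoring n 5 g := by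
  obtain rfl | rfl | h : n = 3 ∨ n = 4 ∨ (n % 2 = 0 ∧ 6 ≤ n ∧ n ≠ 8 ∧ n ≠ 14) := by
    rcases h with h | ⟨⟨m, hm⟩, h⟩ <;> omega
  · exact ⟨columnColoring [(1, 2), (3, 1), (4, 5)], by decide +kernel⟩
  · exact ⟨columnColoring [(1, 2), (3, 1), (1, 4), (5, 1)], by decide +kernel⟩
  let D : List (ℕ × ℕ) := [(1, 2), (3, 1), (1, 4), (2, 1), (1, 5), (3, 1), (1, 2), (4, 1), (1, 3),
    (5, 1)]
  obtain h | h | h : n % 6 = 0 ∨ n % 6 = 4 ∨ n % 6 = 2 := by omega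
  · refine ⟨prefixedColoring [], ?_⟩
    obtain rfl | h : n = 6 ∨ 12 ≤ n := by omega
    · decide +kernel
    · obtain ⟨a, rfl⟩ : ∃ a, n = 0 + 6 * a := ⟨n / 6, by omega⟩
      exact isCyclicColoring_prefixedColoring (L := []) (by omega) (by decide +kernel) (by omega)
  · refine ⟨prefixedColoring D, ?_⟩
    obtain rfl | rfl | h : n = 10 ∨ n = 16 ∨ 22 ≤ n := by omega
    · decide +kernel
    · decide +kernel
    · obtain ⟨a, rfl⟩ : ∃ a, n = 10 + 6 * a := ⟨(n - 10) / 6, by omega⟩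
      exact isCyclicColoring_prefixedColoring (L := D) (by omega) (by decide +kernel) (by omega)
  · refine ⟨prefixedColoring (D ++ D), ?_⟩
    obtain rfl | rfl | h : n = 20 ∨ n = 26 ∨ 32 ≤ n := by omega
    · decide +kernel
    · decide +kernel
    · obtain ⟨a, rfl⟩ : ∃ a, n = 20 + 6 * a := ⟨(n - 20) / 6, by omega⟩
      exact isCyclicColoring_prefixedColoring (L := D ++ D) (by omega) (by decide +kernel)
        (by omega)

theorem exists_isCyclicColoring_six {n : ℕ} (h : n = 5 ∨ n = 14 ∨ (Odd n ∧ 11 ≤ n)) :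
    ∃ g, IsCyclicColoring n 6 g := by
  obtain rfl | rfl | h : n = 5 ∨ n = 14 ∨ (n % 2 = 1 ∧ 11 ≤ n) := by
    rcases h with h | h | ⟨⟨m, hm⟩, h⟩ <;> omega
  · exact ⟨columnColoring [(1, 2), (3, 1), (1, 4), (2, 1), (5, 6)], by decide +kernel⟩
  · exact ⟨columnColoring [(1, 2), (3, 1), (1, 4), (2, 1), (1, 3), (5, 1), (1, 6), (2, 1), (1, 3),
      (4, 1), (1, 2), (3, 1), (1, 5), (6, 1)], by decide +kernel⟩
  obtain h | h | h : n % 6 = 5 ∨ n % 6 = 1 ∨ n % 6 = 3 := by omega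
  · let L : List (ℕ × ℕ) := [(1, 2), (3, 1), (1, 4), (2, 1), (6, 5)]
    refine ⟨prefixedColoring L, ?_⟩
    obtain rfl | h : n = 11 ∨ 17 ≤ n := by omega
    · decide +kernel
    · obtain ⟨a, rfl⟩ : ∃ a, n = 5 + 6 * a := ⟨(n - 5) / 6, by omega⟩
      exact isCyclicColoring_prefixedColoring (L := L) (by omega) (by decide +kernel) (by omega)
  · let L : List (ℕ × ℕ) := [(1, 6), (3, 1), (1, 2), (4, 1), (1, 3), (2, 1), (6, 5)]
    refine ⟨prefixedColoring L, ?_⟩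
    obtain rfl | h : n = 13 ∨ 19 ≤ n := by omega
    · decide +kernel
    · obtain ⟨a, rfl⟩ : ∃ a, n = 7 + 6 * a := ⟨(n - 7) / 6, by omega⟩
      exact isCyclicColoring_prefixedColoring (L := L) (by omega) (by decide +kernel) (by omega)
  · let L : List (ℕ × ℕ) := [(1, 2), (4, 1), (1, 6), (2, 1), (3, 5), (1, 2), (4, 1), (1, 3), (6, 1)]
    refine ⟨prefixedColoring L, ?_⟩
    obtain rfl | h : n = 15 ∨ 21 ≤ n := by omega
    · decide +kernel
    · obtain ⟨a, rfl⟩ : ∃ a, n = 9 + 6 * a := ⟨(n - 9) / 6, by omega⟩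
      exact isCyclicColoring_prefixedColoring (L := L) (by omega) (by decide +kernel) (by omega)

theorem exists_isCyclicColoring_seven {n : ℕ} (h : n = 7 ∨ n = 8 ∨ n = 9) :
    ∃ g, IsCyclicColoring n 7 g := by
  obtain rfl | rfl | rfl := h
  · exact ⟨columnColoring [(1, 2), (3, 1), (1, 4), (2, 1), (1, 3), (5, 1), (6, 7)],
      by decide +kernel⟩
  · exact ⟨columnColoring [(1, 2), (3, 1), (1, 4), (2, 1), (1, 3), (5, 1), (1, 6), (7, 1)],
      by decide +kernel⟩
  · exact ⟨columnColoring [(1, 2), (3, 1), (1, 4), (2, 1), (1, 3), (5, 1), (1, 2), (4, 1), (6, 7)],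
      by decide +kernel⟩

theorem packingChromaticNumber_circularLadder_eq {n k : ℕ} (hn : 2 ≤ n)
    (hle : ∃ g, IsCyclicColoring n (k + 1) g) (hlt : ∀ F, ¬ IsLadderColoring n k F) :
    packingChromaticNumber (circularLadder n) = k + 1 := by
  have : NeZero n := ⟨by omega⟩
  obtain ⟨g, hg⟩ := hle
  refine (Nat.sInf_upward_closed_eq_succ_iff ?_ k).2 ⟨hg.exists_isPackingColoring, ?_⟩
  · rintro k₁ k₂ hk ⟨π, hπ⟩
    exact ⟨π, fun v => ⟨(hπ.1 v).1, (hπ.1 v).2.trans hk⟩, hπ.2⟩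
  · rintro ⟨π, hπ⟩
    obtain ⟨F, hF⟩ := exists_isLadderColoring hn hπ
    exact hlt F hF

theorem packingChromaticNumber_circularLadder (n : ℕ) (hn : 3 ≤ n) :
    packingChromaticNumber (circularLadder n) =
      if n = 3 ∨ (Even n ∧ n ≠ 8 ∧ n ≠ 14) then 5
      else if n = 7 ∨ n = 8 ∨ n = 9 then 7
      else 6 := by
  split_ifs with h₅ h₇
  · exact packingChromaticNumber_circularLadder_eq (by omega)
      (exists_isCyclicColoring_five hn h₅) (not_isLadderColoring_four hn)
  · exact packingChromaticNumber_circularLadder_eq (by omega)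
      (exists_isCyclicColoring_seven h₇) (not_isLadderColoring_six h₇)
  · have hcase : n = 14 ∨ (Odd n ∧ 5 ≤ n) := by
      rw [← Nat.not_even_iff_odd]
      by_cases he : Even n
      · have : n = 8 ∨ n = 14 := by tauto
        omega
      · refine Or.inr ⟨he, ?_⟩
        have : n ≠ 4 := fun h => he (h ▸ by decide)
        omega
    refine packingChromaticNumber_circularLadder_eq (by omega)
      (exists_isCyclicColoring_six ?_) (not_isLadderColoring_five (by tauto))
    rcases hcase with h | ⟨hodd, h⟩
    · exact Or.inr (Or.inl h)
    · obtain rfl | h : n = 5 ∨ 11 ≤ n := by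
        obtain ⟨m, hm⟩ := hodd
        omega
      · exact Or.inl rfl
      · exact Or.inr (Or.inr ⟨hodd, h⟩)
end

section
/- For every odd integer r ≥ 3, the packing chromatic number of the H-graph H(r) is strictly greater than 5. -/
/-- The H-graph `H(r)`: vertices `uᵢ = (0, i)`, `vᵢ = (1, i)`, `wᵢ = (2, i)` for
`i : ZMod (2*r)`, with edges `uᵢuᵢ₊₁`, `wᵢwᵢ₊₁`, `uᵢvᵢ`, `vᵢwᵢ` (for all `i`) and
`v_{2j}v_{2j+1}` for `0 ≤ j ≤ r-1`. -/
def Hgraph (r : ℕ) : SimpleGraph (Fin 3 × ZMod (2 * r)) :=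
  SimpleGraph.fromRel (fun x y =>
    (∃ i : ZMod (2 * r), x = ((0 : Fin 3), i) ∧ y = ((0 : Fin 3), i + 1)) ∨
    (∃ i : ZMod (2 * r), x = ((2 : Fin 3), i) ∧ y = ((2 : Fin 3), i + 1)) ∨
    (∃ i : ZMod (2 * r), x = ((0 : Fin 3), i) ∧ y = ((1 : Fin 3), i)) ∨
    (∃ i : ZMod (2 * r), x = ((1 : Fin 3), i) ∧ y = ((2 : Fin 3), i)) ∨
    (∃ j : ℕ, j < r ∧ x = ((1 : Fin 3), ((2 * j : ℕ) : ZMod (2 * r))) ∧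
      y = ((1 : Fin 3), ((2 * j + 1 : ℕ) : ZMod (2 * r)))))

/-- The distance between the vertices of index `m` and `n` in three consecutive blocks of an
H-graph, where index `n` stands for row `n % 3` and column `n / 3`. -/
def windowDist (m n : ℕ) : ℕ :=
  let d := (m / 3 - n / 3) + (n / 3 - m / 3)
  if m % 3 = n % 3 then
    if m % 3 = 1 ∧ m / 6 ≠ n / 6 then d + 2 else d
  else if m % 3 = 1 ∨ n % 3 = 1 then d + 1 else d + 2

/-- Whether colour `c` may be given to index `n` when `l` lists the colours of the preceding
indices, the latest first. -/
def admissibleColor (c n : ℕ) : List ℕ → Bool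
  | [] => true
  | a :: l => (a != c || decide (c < windowDist l.length n)) && admissibleColor c n l

/-- All packing `5`-colourings of the first `n` indices, as lists with the latest index first. -/
def prefixColorings : ℕ → List (List ℕ)
  | 0 => [[]]
  | n + 1 => (prefixColorings n).flatMap fun l =>
      ([1, 2, 3, 4, 5].filter fun c => admissibleColor c n l).map (· :: l)

/-- The values of `f` at `n - 1, …, 0`. -/
def valuesBelow (f : ℕ → ℕ) : ℕ → List ℕ
  | 0 => []
  | n + 1 => f n :: valuesBelow f n

lemma length_valuesBelow (f : ℕ → ℕ) (n : ℕ) : (valuesBelow f n).length = n := by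
  induction n with
  | zero => rfl
  | succ n ih => simp [valuesBelow, ih]

lemma admissibleColor_valuesBelow {f : ℕ → ℕ} {c n k : ℕ}
    (h : ∀ m < k, f m = c → c < windowDist m n) :
    admissibleColor c n (valuesBelow f k) = true := by
  induction k with
  | zero => rfl
  | succ k ih =>
    simp only [valuesBelow, admissibleColor, Bool.and_eq_true, Bool.or_eq_true,
      bne_iff_ne, decide_eq_true_eq, length_valuesBelow]
    refine ⟨?_, ih fun m hm => h m (by omega)⟩
    exact or_iff_not_imp_left.2 fun hc => h k (by omega) (not_not.1 hc)

lemma valuesBelow_mem_prefixColorings {f : ℕ → ℕ} {n : ℕ}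
    (hf : ∀ m < n, 1 ≤ f m ∧ f m ≤ 5)
    (h : ∀ l < n, ∀ m < l, f m = f l → f l < windowDist m l) :
    valuesBelow f n ∈ prefixColorings n := by
  induction n with
  | zero => simp [valuesBelow, prefixColorings]
  | succ n ih =>
    simp only [prefixColorings, List.mem_flatMap, List.mem_map, List.mem_filter]
    refine ⟨valuesBelow f n, ih (fun m hm => hf m (by omega)) fun l hl => h l (by omega),
      f n, ⟨?_, admissibleColor_valuesBelow (h n (by omega))⟩, rfl⟩
    have := hf n (by omega)
    simp only [List.mem_cons, List.not_mem_nil, or_false]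
    omega

/-- In a colouring of three blocks, listed backwards, colour `5` occurs on the middle row of
exactly one of the first two blocks. -/
def alternatesFive (l : List ℕ) : Bool :=
  (l.getD 16 0 == 5 || l.getD 13 0 == 5) != (l.getD 10 0 == 5 || l.getD 7 0 == 5)

lemma all_alternatesFive : (prefixColorings 18).all alternatesFive = true := by
  decide +kernel

lemma five_alternates {f : ℕ → ℕ} (hf : ∀ m < 18, 1 ≤ f m ∧ f m ≤ 5)
    (h : ∀ l < 18, ∀ m < l, f m = f l → f l < windowDist m l) :
    (f 7 = 5 ∨ f 10 = 5) ↔ ¬ (f 1 = 5 ∨ f 4 = 5) := by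
  have := List.all_eq_true.1 all_alternatesFive _ (valuesBelow_mem_prefixColorings hf h)
  simp [alternatesFive, valuesBelow] at this
  grind

lemma exists_windowDist_descent : ∀ m < 18, ∀ n < 18, m ≠ n →
    ∃ k < 18, windowDist m k = 1 ∧ windowDist k n < windowDist m n := by
  decide +kernel

lemma edge_of_windowDist_eq_one {m n : ℕ} (hmn : m < n) (h : windowDist m n = 1) :
    (n = m + 3 ∧ m % 3 ≠ 1) ∨ (n = m + 1 ∧ m % 3 ≠ 2) ∨ (n = m + 3 ∧ m % 6 = 1) := by
  simp only [windowDist] at h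
  grind

lemma windowDist_comm (m n : ℕ) : windowDist m n = windowDist n m := by
  simp only [windowDist]
  grind

/-- The vertex of `H(r)` with index `n` in the window that starts at block `j`. -/
def windowVertex (r j n : ℕ) : Fin 3 × ZMod (2 * r) :=
  (Fin.ofNat 3 n, ((2 * j + n / 3 : ℕ) : ZMod (2 * r)))

lemma windowVertex_inj {r j m n : ℕ} (hr : 3 ≤ r) (hm : m < 18) (hn : n < 18)
    (h : windowVertex r j m = windowVertex r j n) : m = n := by
  obtain ⟨h1, h2⟩ := Prod.ext_iff.1 h
  have h1 : m % 3 = n % 3 := by simpa [windowVertex, Fin.ext_iff] using h1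
  have h2 : m / 3 ≡ n / 3 [MOD 2 * r] :=
    Nat.ModEq.add_left_cancel' _ ((ZMod.natCast_eq_natCast_iff _ _ _).1 h2)
  have h3 := Nat.ModEq.eq_of_lt_of_lt h2 (by omega) (by omega)
  omega

lemma adj_windowVertex {r j m n : ℕ} (hr : 3 ≤ r) (hm : m < 18) (hn : n < 18)
    (h : windowDist m n = 1) :
    (Hgraph r).Adj (windowVertex r j m) (windowVertex r j n) := by
  wlog hmn : m < n generalizing m n
  · refine (this hn hm (windowDist_comm m n ▸ h) (lt_of_le_of_ne (by omega) ?_)).symm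
    rintro rfl
    simp [windowDist] at h
  rw [Hgraph, SimpleGraph.fromRel_adj]
  refine ⟨fun e => hmn.ne (windowVertex_inj hr hm hn e), Or.inl ?_⟩
  have row : ∀ k : ℕ, ∀ a : Fin 3, k % 3 = a → Fin.ofNat 3 k = a := fun k a hk => Fin.ext hk
  rcases edge_of_windowDist_eq_one hmn h with ⟨rfl, h3⟩ | ⟨rfl, h3⟩ | ⟨rfl, h3⟩
  · have hc : 2 * j + (m + 3) / 3 = 2 * j + m / 3 + 1 := by omega
    obtain h0 | h2 : m % 3 = 0 ∨ m % 3 = 2 := by omega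
    · refine Or.inl ⟨((2 * j + m / 3 : ℕ) : ZMod (2 * r)), ?_, ?_⟩
      · rw [windowVertex, row m 0 h0]
      · rw [windowVertex, row (m + 3) 0 (by simpa using h0), hc, Nat.cast_succ]
    · refine Or.inr (Or.inl ⟨((2 * j + m / 3 : ℕ) : ZMod (2 * r)), ?_, ?_⟩)
      · rw [windowVertex, row m 2 h2]
      · rw [windowVertex, row (m + 3) 2 (by simpa using h2), hc, Nat.cast_succ]
  · have hc : (m + 1) / 3 = m / 3 := by omega
    obtain h0 | h1 : m % 3 = 0 ∨ m % 3 = 1 := by omega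
    · refine Or.inr (Or.inr (Or.inl ⟨((2 * j + m / 3 : ℕ) : ZMod (2 * r)), ?_, ?_⟩))
      · rw [windowVertex, row m 0 h0]
      · rw [windowVertex, row (m + 1) 1 (show (m + 1) % 3 = 1 by omega), hc]
    · refine Or.inr (Or.inr (Or.inr (Or.inl ⟨((2 * j + m / 3 : ℕ) : ZMod (2 * r)), ?_, ?_⟩)))
      · rw [windowVertex, row m 1 h1]
      · rw [windowVertex, row (m + 1) 2 (show (m + 1) % 3 = 2 by omega), hc]
  · have hb : 2 * j + m / 3 = 2 * ((j + m / 6) % r) + 2 * r * ((j + m / 6) / r) := by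
      have := Nat.mod_add_div (j + m / 6) r
      have h6 : m / 3 = 2 * (m / 6) := by omega
      rw [h6, mul_assoc, ← mul_add, ← mul_add, this]
    have hc : 2 * j + (m + 3) / 3 =
        2 * ((j + m / 6) % r) + 1 + 2 * r * ((j + m / 6) / r) := by omega
    have hcast : ∀ a b : ℕ, ((a + 2 * r * b : ℕ) : ZMod (2 * r)) = a := fun a b =>
      (ZMod.natCast_eq_natCast_iff _ _ _).2 (by simp [Nat.ModEq])
    refine Or.inr (Or.inr (Or.inr (Or.inr
      ⟨(j + m / 6) % r, Nat.mod_lt _ (by omega), ?_, ?_⟩)))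
    · rw [windowVertex, row m 1 (show m % 3 = 1 by omega), hb, hcast]
    · rw [windowVertex, row (m + 3) 1 (show (m + 3) % 3 = 1 by omega), hc, hcast]

lemma exists_walk_length_le_windowDist {r j m n : ℕ} (hr : 3 ≤ r) (hm : m < 18) (hn : n < 18) :
    ∃ p : (Hgraph r).Walk (windowVertex r j m) (windowVertex r j n),
      p.length ≤ windowDist m n := by
  induction hd : windowDist m n using Nat.strong_induction_on generalizing m with
  | _ d ih =>
    by_cases hmn : m = n
    · subst hmn
      exact ⟨.nil, Nat.zero_le _⟩
    · obtain ⟨k, hk, h1, hlt⟩ := exists_windowDist_descent m hm n hn hmn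
      obtain ⟨p, hp⟩ := ih _ (hd ▸ hlt) hk rfl
      refine ⟨.cons (adj_windowVertex hr hm hk h1) p, ?_⟩
      rw [SimpleGraph.Walk.length_cons]
      omega

lemma exists_isPackingColoring {V : Type*} [Finite V] (G : SimpleGraph V) :
    ∃ k, ∃ π : V → ℕ, IsPackingColoring G k π := by
  obtain ⟨n, ⟨e⟩⟩ := Finite.exists_equiv_fin V
  refine ⟨n, fun v => e v + 1, fun v => ⟨Nat.le_add_left 1 _, (e v).isLt⟩, fun u v huv h => ?_⟩
  exact absurd (e.injective (Fin.ext (Nat.succ_injective h))) huv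

lemma not_isPackingColoring_Hgraph {r k : ℕ} (hr : 3 ≤ r) (hodd : Odd r) (hk : k ≤ 5)
    (π : Fin 3 × ZMod (2 * r) → ℕ) : ¬ IsPackingColoring (Hgraph r) k π := by
  rintro ⟨hπ, hdist⟩
  let five : ℕ → Prop := fun j =>
    π (1, ((2 * j : ℕ) : ZMod (2 * r))) = 5 ∨ π (1, ((2 * j + 1 : ℕ) : ZMod (2 * r))) = 5
  have hstep : ∀ j, five (j + 1) ↔ ¬ five j := by
    intro j
    refine five_alternates (f := fun n => π (windowVertex r j n))
      (fun m _ => ⟨(hπ _).1, (hπ _).2.trans hk⟩) fun l hl m hm heq => ?_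
    obtain ⟨p, hp⟩ := exists_walk_length_le_windowDist (j := j) hr (hm.trans hl) hl
    have := hdist _ _ (fun e => hm.ne (windowVertex_inj hr (hm.trans hl) hl e)) heq p
    exact heq ▸ this.trans_le hp
  have hparity : ∀ j, five j ↔ (five 0 ↔ Even j) := by
    intro j
    induction j with
    | zero => simp
    | succ j ih =>
      rw [hstep, ih, Nat.even_add_one]
      tauto
  have hperiod : five r ↔ five 0 := by
    simp only [five, Nat.cast_add, ZMod.natCast_self, mul_zero, Nat.cast_zero]
  have := hparity r
  rw [hperiod] at this
  have hne := Nat.not_even_iff_odd.2 hodd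
  tauto

theorem Hgraph_odd_gt_five (r : ℕ) (hr : 3 ≤ r) (hodd : Odd r) :
    5 < packingChromaticNumber (Hgraph r) := by
  have : NeZero (2 * r) := ⟨by omega⟩
  by_contra! hle
  obtain ⟨π, hπ⟩ := Nat.sInf_mem (exists_isPackingColoring (Hgraph r))
  exact not_isPackingColoring_Hgraph hr hodd hle π hπ
end
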